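/- The normalised hyperplane complement Υ_reg^N = {Z ∈ Υ_reg : φ^I(Z) = π/2} is a W-invariant subset of Υ_reg, and the homeomorphism Υ_reg ≅ S¹ × Υ_reg^N given by the free S¹-scaling action can be chosen W-equivariantly (when I ≠ {0}). -/

import Mathlib

noncomputable def coxEntry {B : Type*} (M : CoxeterMatrix B) (s t : B) : ℝ :=
  if M s t = 0 then -2 else -2 * Real.cos (Real.pi / (M s t))

noncomputable def coxForm {B : Type*} [Fintype B] (M : CoxeterMatrix B) (v w : B → ℝ) : ℝ :=
  ∑ s, ∑ t, v s * w t * coxEntry M s t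

/-- The simple root `α_s` in `RΛ ≅ (B → ℝ)`. -/
noncomputable def simpleRoot {B : Type*} [DecidableEq B] (s : B) : B → ℝ := Pi.single s 1

/-- The set of real roots: the `W`-orbit of the simple roots under the Tits representation. -/
def rootSet {B : Type*} [DecidableEq B] {W : Type*} [Group W]
    (ρ : W →* ((B → ℝ) ≃ₗ[ℝ] (B → ℝ))) : Set (B → ℝ) :=
  {v | ∃ (w : W) (s : B), v = ρ w (simpleRoot s)}

/-- The set of positive real roots. -/
def posRootSet {B : Type*} [DecidableEq B] {W : Type*} [Group W]
    (ρ : W →* ((B → ℝ) ≃ₗ[ℝ] (B → ℝ))) : Set (B → ℝ) :=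
  {v ∈ rootSet ρ | ∀ i, 0 ≤ v i}

/-- The set `K = {v ∈ ℝ_{≥0}Λ : B(v, α_s) ≤ 0 for all s}`. -/
noncomputable def coneK {B : Type*} [Fintype B] [DecidableEq B] (M : CoxeterMatrix B) :
    Set (B → ℝ) :=
  {v | (∀ i, 0 ≤ v i) ∧ ∀ s, coxForm M v (simpleRoot s) ≤ 0}

/-- The closed imaginary cone `I = closure (W · K)`. -/
noncomputable def imagCone {B : Type*} [Fintype B] [DecidableEq B] (M : CoxeterMatrix B)
    {W : Type*} [Group W] (ρ : W →* ((B → ℝ) ≃ₗ[ℝ] (B → ℝ))) : Set (B → ℝ) :=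
  closure {v | ∃ (w : W), ∃ k ∈ coneK M, v = ρ w k}


/-- The pairing between the complexified dual space `(RΛ)*_ℂ = Hom_ℝ(RΛ, ℂ)` (in coordinates:
`z : B → ℂ`, with `z i = Z(α_i)`) and `RΛ`. -/
noncomputable def evalC {B : Type*} [Fintype B] (z : B → ℂ) (v : B → ℝ) : ℂ := ∑ i, (v i : ℂ) * z i

/-- The hyperplane complement `Υ_reg`: the complement in `(RΛ)*_ℂ` of the hyperplanes `H_v`
for nonzero `v` in the closed imaginary cone and the hyperplanes `H_α` for positive real
roots `α`. -/
noncomputable def upsReg {B : Type*} [Fintype B] [DecidableEq B] (M : CoxeterMatrix B)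
    {W : Type*} [Group W] (ρ : W →* ((B → ℝ) ≃ₗ[ℝ] (B → ℝ))) : Set (B → ℂ) :=
  {z | (∀ v ∈ imagCone M ρ, v ≠ 0 → evalC z v ≠ 0) ∧ ∀ α ∈ posRootSet ρ, evalC z α ≠ 0}

/-- The argument `φ^I(Z)` of the middle ray of the proper closed convex cone `Z(I) ⊆ ℂ`
(for `Z ∈ Υ` with `I ≠ {0}`): the average of the extremal arguments of `Z(I \ {0})`. -/
noncomputable def phiI {B : Type*} [Fintype B] [DecidableEq B] (M : CoxeterMatrix B)
    {W : Type*} [Group W] (ρ : W →* ((B → ℝ) ≃ₗ[ℝ] (B → ℝ))) (z : B → ℂ) : ℝ :=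
  (sSup (Complex.arg '' ((fun v => evalC z v) '' (imagCone M ρ \ {0}))) +
    sInf (Complex.arg '' ((fun v => evalC z v) '' (imagCone M ρ \ {0})))) / 2

open Classical in
/-- The normalised hyperplane complement `Υ_reg^N = {Z ∈ Υ_reg : φ^I(Z) = π/2}`; by
convention `Υ_reg^N := Υ_reg` when `I = {0}`. -/
noncomputable def upsRegN {B : Type*} [Fintype B] [DecidableEq B] (M : CoxeterMatrix B)
    {W : Type*} [Group W] (ρ : W →* ((B → ℝ) ≃ₗ[ℝ] (B → ℝ))) : Set (B → ℂ) :=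
  if imagCone M ρ = {0} then upsReg M ρ
  else {z ∈ upsReg M ρ | phiI M ρ z = Real.pi / 2}

/-- The contragredient action of `w ∈ W` on the complexified dual space, in coordinates:
`(w · Z)(v) = Z(ρ(w⁻¹) v)`. -/
noncomputable def wact {B : Type*} [Fintype B] [DecidableEq B]
    {W : Type*} [Group W] (ρ : W →* ((B → ℝ) ≃ₗ[ℝ] (B → ℝ))) (w : W) (z : B → ℂ) :
    B → ℂ :=
  fun i => evalC z (ρ w⁻¹ (simpleRoot i))

/-! ### The bilinear form -/

lemma coxEntry_symm {B : Type*} (M : CoxeterMatrix B) (s t : B) :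
    coxEntry M s t = coxEntry M t s := by
  unfold coxEntry
  rw [M.symmetric s t]

lemma coxEntry_self {B : Type*} (M : CoxeterMatrix B) (s : B) : coxEntry M s s = 2 := by
  simp [coxEntry]

section form
variable {B : Type*} [Fintype B] (M : CoxeterMatrix B)

lemma coxForm_symm (v w : B → ℝ) : coxForm M v w = coxForm M w v := by
  unfold coxForm
  rw [Finset.sum_comm]
  refine Finset.sum_congr rfl fun s _ => Finset.sum_congr rfl fun t _ => ?_
  rw [coxEntry_symm M t s]; ring

lemma coxForm_add_right (u v w : B → ℝ) :
    coxForm M u (v + w) = coxForm M u v + coxForm M u w := by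
  unfold coxForm
  simp only [← Finset.sum_add_distrib]
  refine Finset.sum_congr rfl fun s _ => Finset.sum_congr rfl fun t _ => ?_
  simp only [Pi.add_apply]; ring

lemma coxForm_smul_right (c : ℝ) (u v : B → ℝ) :
    coxForm M u (c • v) = c * coxForm M u v := by
  unfold coxForm
  simp only [Finset.mul_sum]
  refine Finset.sum_congr rfl fun s _ => Finset.sum_congr rfl fun t _ => ?_
  simp only [Pi.smul_apply, smul_eq_mul]; ring

lemma coxForm_sub_right (u v w : B → ℝ) :
    coxForm M u (v - w) = coxForm M u v - coxForm M u w := by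
  have := coxForm_add_right M u (v - w) w
  rw [sub_add_cancel] at this
  linarith

lemma coxForm_add_left (u v w : B → ℝ) :
    coxForm M (u + v) w = coxForm M u w + coxForm M v w := by
  rw [coxForm_symm, coxForm_add_right, coxForm_symm M w u, coxForm_symm M w v]

lemma coxForm_smul_left (c : ℝ) (u v : B → ℝ) :
    coxForm M (c • u) v = c * coxForm M u v := by
  rw [coxForm_symm, coxForm_smul_right, coxForm_symm M v u]

lemma coxForm_sub_left (u v w : B → ℝ) :
    coxForm M (u - v) w = coxForm M u w - coxForm M v w := by
  rw [coxForm_symm, coxForm_sub_right, coxForm_symm M w u, coxForm_symm M w v]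

lemma coxForm_simple [DecidableEq B] (s t : B) :
    coxForm M (simpleRoot s) (simpleRoot t) = coxEntry M s t := by
  unfold coxForm simpleRoot
  rw [Finset.sum_eq_single s, Finset.sum_eq_single t]
  · simp
  · intro b _ hb; simp [hb]
  · simp
  · intro b _ hb; simp [hb]
  · simp

lemma vec_eq_sum [DecidableEq B] (v : B → ℝ) : v = ∑ s, v s • simpleRoot s := by
  ext i
  simp [simpleRoot, Finset.sum_apply, Pi.single_apply]

lemma coxForm_eq_sum_right [DecidableEq B] (u v : B → ℝ) :
    coxForm M u v = ∑ t, v t * coxForm M u (simpleRoot t) := by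
  have key : ∀ t, coxForm M u (simpleRoot t) = ∑ s, u s * coxEntry M s t := by
    intro t
    unfold coxForm simpleRoot
    refine Finset.sum_congr rfl fun s _ => ?_
    rw [Finset.sum_eq_single t]
    · simp
    · intro b _ hb; simp [hb]
    · simp
  simp only [key]
  unfold coxForm
  rw [Finset.sum_comm]
  refine Finset.sum_congr rfl fun s _ => ?_
  rw [Finset.mul_sum]
  refine Finset.sum_congr rfl fun t _ => ?_
  ring

end form

lemma simpleRoot_nonneg {B : Type*} [DecidableEq B] (s : B) : 0 ≤ simpleRoot s := by
  intro i
  by_cases h : i = s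
  · subst h; simp [simpleRoot]
  · simp [simpleRoot, h]

/-- The coefficient sequence of the rank two computation. -/
noncomputable def dihCoef (c : ℝ) : ℕ → ℝ
  | 0 => 0
  | 1 => 1
  | (n + 2) => c * dihCoef c (n + 1) - dihCoef c n

lemma dihCoef_two (n : ℕ) : dihCoef 2 n = n ∧ dihCoef 2 (n + 1) = n + 1 := by
  induction n with
  | zero => simp [dihCoef]
  | succ n ih =>
    refine ⟨by rw [ih.2]; push_cast; ring, ?_⟩
    rw [dihCoef, ih.1, ih.2]; push_cast; ring

lemma dihCoef_cos (θ : ℝ) (n : ℕ) :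
    dihCoef (2 * Real.cos θ) n * Real.sin θ = Real.sin (n * θ) ∧
    dihCoef (2 * Real.cos θ) (n + 1) * Real.sin θ = Real.sin ((n + 1 : ℕ) * θ) := by
  induction n with
  | zero => simp [dihCoef]
  | succ n ih =>
    refine ⟨ih.2, ?_⟩
    rw [dihCoef, sub_mul, ih.1, mul_assoc, ih.2]
    have e1 : ((n + 1 + 1 : ℕ) : ℝ) * θ = ((n + 1 : ℕ) : ℝ) * θ + θ := by push_cast; ring
    have e2 : ((n : ℕ) : ℝ) * θ = ((n + 1 : ℕ) : ℝ) * θ - θ := by push_cast; ring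
    rw [e1, e2, Real.sin_add, Real.sin_sub]; ring

lemma dihCoef_nonneg {B : Type*} (M : CoxeterMatrix B) {s t : B} (hst : s ≠ t) (k : ℕ)
    (hk : M s t ≠ 0 → k ≤ M s t) : 0 ≤ dihCoef (-coxEntry M s t) k := by
  unfold coxEntry
  split_ifs with h
  · rw [neg_neg, (dihCoef_two k).1]; positivity
  · have hk := hk h
    have h1 : M s t ≠ 1 := M.off_diagonal s t hst
    have h2 : (2 : ℝ) ≤ (M s t : ℝ) := by
      have : 2 ≤ M s t := by omega
      exact_mod_cast this
    have hpi := Real.pi_pos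
    set m : ℝ := (M s t : ℝ) with hm
    have hs : 0 < Real.sin (Real.pi / m) := by
      apply Real.sin_pos_of_pos_of_lt_pi (by positivity)
      rw [div_lt_iff₀ (by linarith)]; nlinarith
    have e : -(-2 * Real.cos (Real.pi / m)) = 2 * Real.cos (Real.pi / m) := by ring
    rw [e]
    have h3 := (dihCoef_cos (Real.pi / m) k).1
    have hkm : (k : ℝ) ≤ m := by rw [hm]; exact Nat.cast_le.2 hk
    have h4 : 0 ≤ Real.sin (k * (Real.pi / m)) := by
      apply Real.sin_nonneg_of_nonneg_of_le_pi (by positivity)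
      rw [← mul_div_assoc, div_le_iff₀ (by linarith)]; nlinarith
    rw [← h3] at h4
    exact nonneg_of_mul_nonneg_left h4 hs

section roots
variable {B : Type*} [Fintype B] [DecidableEq B] {M : CoxeterMatrix B}
  {W : Type*} [Group W] (cs : CoxeterSystem M W)
  (ρ : W →* ((B → ℝ) ≃ₗ[ℝ] (B → ℝ)))
  (hρ : ∀ (s : B) (v : B → ℝ),
      ρ (cs.simple s) v = v - coxForm M (simpleRoot s) v • simpleRoot s)

lemma rho_mul (w w' : W) (v : B → ℝ) : ρ (w * w') v = ρ w (ρ w' v) := by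
  rw [map_mul]; rfl

lemma rho_one (v : B → ℝ) : ρ 1 v = v := by
  rw [map_one]; rfl

lemma rho_inv_rho (w : W) (v : B → ℝ) : ρ w⁻¹ (ρ w v) = v := by
  rw [← rho_mul, inv_mul_cancel, rho_one]

lemma rho_rho_inv (w : W) (v : B → ℝ) : ρ w (ρ w⁻¹ v) = v := by
  rw [← rho_mul, mul_inv_cancel, rho_one]

include hρ

lemma rho_simple_self (s : B) : ρ (cs.simple s) (simpleRoot s) = - simpleRoot s := by
  rw [hρ, coxForm_simple, coxEntry_self, two_smul]; abel

lemma rho_simple_other (s t : B) :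
    ρ (cs.simple s) (simpleRoot t) = simpleRoot t + (-coxEntry M s t) • simpleRoot s := by
  rw [hρ, coxForm_simple, neg_smul, sub_eq_add_neg]

lemma rho_alternating (s t : B) (k : ℕ) :
    ρ (cs.wordProd (CoxeterSystem.alternatingWord s t k)) (simpleRoot s) =
      if Even k then dihCoef (-coxEntry M s t) (k + 1) • simpleRoot s
          + dihCoef (-coxEntry M s t) k • simpleRoot t
        else dihCoef (-coxEntry M s t) k • simpleRoot s
          + dihCoef (-coxEntry M s t) (k + 1) • simpleRoot t := by
  induction k with
  | zero => simp [CoxeterSystem.alternatingWord, dihCoef]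
  | succ k ih =>
    rw [CoxeterSystem.alternatingWord_succ', cs.wordProd_cons, rho_mul, ih]
    by_cases hk : Even k
    · have hk' : ¬ Even (k + 1) := by rw [Nat.even_add_one]; simpa using hk
      rw [if_pos hk, if_pos hk, if_neg hk', map_add, map_smul, map_smul,
        rho_simple_self cs ρ hρ, rho_simple_other cs ρ hρ, coxEntry_symm M t s, dihCoef]
      module
    · have hk' : Even (k + 1) := by rw [Nat.even_add_one]; exact hk
      rw [if_neg hk, if_neg hk, if_pos hk', map_add, map_smul, map_smul,
        rho_simple_self cs ρ hρ, rho_simple_other cs ρ hρ, dihCoef]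
      module

lemma root_nonneg_aux (n : ℕ) : ∀ (w : W) (s : B), cs.length w = n →
    ¬ cs.IsRightDescent w s → 0 ≤ ρ w (simpleRoot s) := by
  induction n using Nat.strong_induction_on with
  | _ n ih =>
  intro w s hwn hws
  by_cases hw1 : w = 1
  · subst hw1; rw [rho_one]; exact simpleRoot_nonneg s
  obtain ⟨t, ht⟩ := cs.exists_rightDescent_of_ne_one hw1
  have hst : s ≠ t := by rintro rfl; exact hws ht
  classical
  let P : ℕ → Prop := fun k => ∃ v : W, w = v * cs.wordProd (CoxeterSystem.alternatingWord s t k)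
    ∧ cs.length v + k = cs.length w
  have hP1 : P 1 := by
    refine ⟨w * cs.simple t, ?_, ?_⟩
    · simp [CoxeterSystem.alternatingWord]
    · exact cs.isRightDescent_iff.1 ht
  have hPle : ∀ k, P k → k ≤ cs.length w := by
    rintro k ⟨v, -, h⟩; omega
  let k := Nat.findGreatest P (cs.length w)
  have hk1 : 1 ≤ k := Nat.le_findGreatest (hPle 1 hP1) hP1
  obtain ⟨v, hv, hvl⟩ : P k := Nat.findGreatest_spec (hPle 1 hP1) hP1
  have hmax : ¬ P (k + 1) := fun h => by
    have := Nat.le_findGreatest (hPle _ h) h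
    change k + 1 ≤ k at this
    omega
  clear_value k
  have hx : ¬ cs.IsRightDescent v (if Even k then t else s) := by
    intro hd
    apply hmax
    refine ⟨v * cs.simple (if Even k then t else s), ?_, ?_⟩
    · rw [CoxeterSystem.alternatingWord_succ', cs.wordProd_cons, hv]
      simp [mul_assoc]
    · have := cs.isRightDescent_iff.1 hd
      omega
  obtain ⟨j, rfl⟩ : ∃ j, k = j + 1 := ⟨k - 1, by omega⟩
  have hy : ¬ cs.IsRightDescent v (if Even j then t else s) := by
    intro hd
    have h1 := cs.isRightDescent_iff.1 hd
    have h2 : w = (v * cs.simple (if Even j then t else s)) *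
        cs.wordProd (CoxeterSystem.alternatingWord s t j) := by
      rw [hv, CoxeterSystem.alternatingWord_succ', cs.wordProd_cons, mul_assoc]
    have h3 := cs.length_mul_le (v * cs.simple (if Even j then t else s))
        (cs.wordProd (CoxeterSystem.alternatingWord s t j))
    rw [← h2] at h3
    have h4 := cs.length_wordProd_le (CoxeterSystem.alternatingWord s t j)
    rw [CoxeterSystem.length_alternatingWord] at h4
    omega
  have hvst : ¬ cs.IsRightDescent v s ∧ ¬ cs.IsRightDescent v t := by
    by_cases hj : Even j
    · have hj' : ¬ Even (j + 1) := by rw [Nat.even_add_one]; simpa using hj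
      rw [if_pos hj] at hy
      rw [if_neg hj'] at hx
      exact ⟨hx, hy⟩
    · have hj' : Even (j + 1) := by rw [Nat.even_add_one]; exact hj
      rw [if_neg hj] at hy
      rw [if_pos hj'] at hx
      exact ⟨hy, hx⟩
  have hvs := (ih (cs.length v) (by omega) v s rfl hvst.1)
  have hvt := (ih (cs.length v) (by omega) v t rfl hvst.2)
  have hkm : M s t ≠ 0 → j + 1 + 1 ≤ M s t := by
    intro hM
    by_contra hlt
    have hM' : M t s ≠ 0 := by rwa [M.symmetric t s]
    have hnr := cs.not_isReduced_alternatingWord t s (m := j + 1 + 1) hM'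
      (by rw [M.symmetric t s]; omega)
    have h1 := cs.length_wordProd_le (CoxeterSystem.alternatingWord t s (j + 1 + 1))
    have h2 : cs.length (cs.wordProd (CoxeterSystem.alternatingWord t s (j + 1 + 1))) ≠
        (CoxeterSystem.alternatingWord t s (j + 1 + 1)).length := hnr
    rw [CoxeterSystem.length_alternatingWord] at h1 h2
    have h3 := cs.not_isRightDescent_iff.1 hws
    have h4 : w * cs.simple s =
        v * cs.wordProd (CoxeterSystem.alternatingWord t s (j + 1 + 1)) := by
      rw [CoxeterSystem.alternatingWord_succ t s (j + 1), cs.wordProd_concat, hv, mul_assoc]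
    have h5 := cs.length_mul_le v (cs.wordProd (CoxeterSystem.alternatingWord t s (j + 1 + 1)))
    rw [← h4] at h5
    omega
  have c1 := dihCoef_nonneg M hst (j + 1) (fun h => by have := hkm h; omega)
  have c2 := dihCoef_nonneg M hst (j + 1 + 1) hkm
  rw [hv, rho_mul, rho_alternating cs ρ hρ]
  split_ifs <;> rw [map_add, map_smul, map_smul] <;>
    exact add_nonneg (smul_nonneg (by assumption) hvs) (smul_nonneg (by assumption) hvt)

lemma root_nonneg {w : W} {s : B} (h : ¬ cs.IsRightDescent w s) : 0 ≤ ρ w (simpleRoot s) :=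
  root_nonneg_aux cs ρ hρ _ w s rfl h

lemma root_pos_or_neg (w : W) (s : B) :
    0 ≤ ρ w (simpleRoot s) ∨ 0 ≤ - ρ w (simpleRoot s) := by
  by_cases h : cs.IsRightDescent w s
  · right
    have h' := cs.isRightDescent_iff_not_isRightDescent_mul.1 h
    have := root_nonneg cs ρ hρ h'
    rwa [rho_mul, rho_simple_self cs ρ hρ, map_neg] at this
  · exact Or.inl (root_nonneg cs ρ hρ h)

lemma coxForm_rho (w : W) : ∀ u v : B → ℝ, coxForm M (ρ w u) (ρ w v) = coxForm M u v := by
  refine cs.simple_induction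
    (p := fun w => ∀ u v : B → ℝ, coxForm M (ρ w u) (ρ w v) = coxForm M u v) w ?_ ?_ ?_
  · intro s u v
    rw [hρ, hρ]
    simp only [coxForm_sub_left, coxForm_sub_right, coxForm_smul_left, coxForm_smul_right,
      coxForm_simple, coxEntry_self, coxForm_symm M u (simpleRoot s)]
    ring
  · intro u v; rw [rho_one, rho_one]
  · intro w w' h h' u v
    rw [rho_mul, rho_mul, h, h']

end roots

/-! ### The imaginary cone -/

/-- The union of the `W`-translates of `coneK`. -/
def orbK {B : Type*} [Fintype B] [DecidableEq B] (M : CoxeterMatrix B)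
    {W : Type*} [Group W] (ρ : W →* ((B → ℝ) ≃ₗ[ℝ] (B → ℝ))) : Set (B → ℝ) :=
  {v | ∃ (w : W), ∃ k ∈ coneK M, v = ρ w k}

/-- The positive roots that pair positively with `v`. -/
def posPair {B : Type*} [Fintype B] [DecidableEq B] (M : CoxeterMatrix B)
    {W : Type*} [Group W] (ρ : W →* ((B → ℝ) ≃ₗ[ℝ] (B → ℝ))) (v : B → ℝ) : Set (B → ℝ) :=
  {α | α ∈ posRootSet ρ ∧ 0 < coxForm M v α}

section cone
variable {B : Type*} [Fintype B] [DecidableEq B] {M : CoxeterMatrix B}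
  {W : Type*} [Group W] (cs : CoxeterSystem M W)
  (ρ : W →* ((B → ℝ) ≃ₗ[ℝ] (B → ℝ)))
  (hρ : ∀ (s : B) (v : B → ℝ),
      ρ (cs.simple s) v = v - coxForm M (simpleRoot s) v • simpleRoot s)

lemma rootSet_rho {α : B → ℝ} (w : W) (h : α ∈ rootSet ρ) : ρ w α ∈ rootSet ρ := by
  obtain ⟨w', s, rfl⟩ := h
  exact ⟨w * w', s, (rho_mul ρ w w' _).symm⟩

lemma simpleRoot_mem_posRootSet (s : B) : simpleRoot s ∈ posRootSet ρ :=
  ⟨⟨1, s, (rho_one ρ _).symm⟩, simpleRoot_nonneg s⟩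

include hρ

lemma rho_simple_simple (s : B) (v : B → ℝ) :
    ρ (cs.simple s) (ρ (cs.simple s) v) = v := by
  rw [← rho_mul, cs.simple_mul_simple_self, rho_one]

lemma rootSet_pos_or_neg {α : B → ℝ} (h : α ∈ rootSet ρ) :
    α ∈ posRootSet ρ ∨ -α ∈ posRootSet ρ := by
  have hneg : -α ∈ rootSet ρ := by
    obtain ⟨w, s, rfl⟩ := h
    refine ⟨w * cs.simple s, s, ?_⟩
    rw [rho_mul, rho_simple_self cs ρ hρ, map_neg]
  obtain ⟨w, s, rfl⟩ := id h
  rcases root_pos_or_neg cs ρ hρ w s with h1 | h1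
  · exact Or.inl ⟨h, h1⟩
  · exact Or.inr ⟨hneg, h1⟩

lemma posRootSet_simple {α : B → ℝ} (s : B) (h : α ∈ posRootSet ρ) (hne : α ≠ simpleRoot s) :
    ρ (cs.simple s) α ∈ posRootSet ρ := by
  rcases rootSet_pos_or_neg cs ρ hρ (rootSet_rho ρ (cs.simple s) h.1) with h1 | h1
  · exact h1
  exfalso
  have h0 : ∀ t, t ≠ s → α t = 0 := by
    intro t ht
    have h2 := h1.2 t
    have h3 := h.2 t
    rw [hρ] at h2
    simp [simpleRoot, ht] at h2
    linarith
  have he : α = α s • simpleRoot s := by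
    ext t
    by_cases ht : t = s
    · subst ht; simp [simpleRoot]
    · simp [simpleRoot, ht, h0 t ht]
  have hn : coxForm M α α = 2 := by
    obtain ⟨w, r, rfl⟩ := h.1
    rw [coxForm_rho cs ρ hρ, coxForm_simple, coxEntry_self]
  rw [he, coxForm_smul_left, coxForm_smul_right, coxForm_simple, coxEntry_self] at hn
  have hs := h.2 s
  have h1 : α s = 1 := by nlinarith
  rw [h1, one_smul] at he
  exact hne he

lemma rho_coneK_nonneg (n : ℕ) : ∀ (w : W) (k : B → ℝ), cs.length w = n → k ∈ coneK M →
    0 ≤ ρ w k := by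
  induction n with
  | zero =>
    intro w k hw hk
    rw [cs.length_eq_zero_iff] at hw
    subst hw
    rw [rho_one]; exact hk.1
  | succ n ih =>
    intro w k hw hk
    have hw1 : w ≠ 1 := by
      rintro rfl
      simp at hw
    obtain ⟨s, hs⟩ := cs.exists_rightDescent_of_ne_one hw1
    have h1 := cs.isRightDescent_iff.1 hs
    have h2 := cs.isRightDescent_iff_not_isRightDescent_mul.1 hs
    have h3 : w = (w * cs.simple s) * cs.simple s := by simp
    have h4 := ih (w * cs.simple s) k (by omega) hk
    have h5 := root_nonneg cs ρ hρ h2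
    have h6 := hk.2 s
    rw [coxForm_symm] at h6
    rw [h3, rho_mul, hρ, map_sub, map_smul, sub_eq_add_neg, ← neg_smul]
    exact add_nonneg h4 (smul_nonneg (by linarith) h5)

lemma posPair_finite (w : W) {k : B → ℝ} (hk : k ∈ coneK M) :
    (posPair M ρ (ρ w k)).Finite := by
  refine cs.simple_induction_left (p := fun w => (posPair M ρ (ρ w k)).Finite) w ?_ ?_
  · rw [rho_one]
    convert Set.finite_empty
    ext α
    simp only [posPair, Set.mem_ofPred_eq, Set.mem_empty_iff_false, iff_false, not_and, not_lt]
    intro hα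
    rw [coxForm_eq_sum_right]
    exact Finset.sum_nonpos fun t _ => mul_nonpos_of_nonneg_of_nonpos (hα.2 t) (hk.2 t)
  · intro w s h
    refine ((h.image (ρ (cs.simple s))).union (Set.finite_singleton (simpleRoot s))).subset ?_
    rintro α ⟨hα, hp⟩
    by_cases hne : α = simpleRoot s
    · exact Or.inr hne
    · left
      refine ⟨ρ (cs.simple s) α, ⟨posRootSet_simple cs ρ hρ s hα hne, ?_⟩,
        rho_simple_simple cs ρ hρ s α⟩
      rw [← coxForm_rho cs ρ hρ (cs.simple s), rho_simple_simple cs ρ hρ, ← rho_mul]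
      exact hp

lemma mem_orbK_of (n : ℕ) : ∀ v : B → ℝ, (posPair M ρ v).Finite → (posPair M ρ v).ncard = n →
    (∀ w, 0 ≤ ρ w v) → v ∈ orbK M ρ := by
  induction n using Nat.strong_induction_on with
  | _ n ih =>
  intro v hfin hn hpos
  by_cases hK : ∀ s, coxForm M v (simpleRoot s) ≤ 0
  · refine ⟨1, v, ⟨?_, hK⟩, (rho_one ρ v).symm⟩
    have := hpos 1
    rwa [rho_one] at this
  push Not at hK
  obtain ⟨s, hs⟩ := hK
  have hsub : posPair M ρ (ρ (cs.simple s) v) ⊆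
      ρ (cs.simple s) '' (posPair M ρ v \ {simpleRoot s}) := by
    rintro α ⟨hα, hp⟩
    rw [← coxForm_rho cs ρ hρ (cs.simple s), rho_simple_simple cs ρ hρ] at hp
    have hne : α ≠ simpleRoot s := by
      rintro rfl
      rw [rho_simple_self cs ρ hρ, ← neg_one_smul ℝ, coxForm_smul_right] at hp
      linarith
    have hα' := posRootSet_simple cs ρ hρ s hα hne
    refine ⟨ρ (cs.simple s) α, ⟨⟨hα', hp⟩, ?_⟩, rho_simple_simple cs ρ hρ s α⟩
    intro h
    rw [Set.mem_singleton_iff] at h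
    have h2 := rho_simple_simple cs ρ hρ s α
    rw [h, rho_simple_self cs ρ hρ] at h2
    have h3 := hα.2 s
    rw [← h2] at h3
    simp [simpleRoot] at h3
    linarith
  have hfin' : (posPair M ρ v \ {simpleRoot s}).Finite := hfin.subset Set.sdiff_subset
  have hlt : (posPair M ρ (ρ (cs.simple s) v)).ncard < n := by
    have h1 := Set.ncard_le_ncard hsub (hfin'.image _)
    have h2 := Set.ncard_image_le (f := ρ (cs.simple s)) hfin'
    have h3 := Set.ncard_sdiff_singleton_lt_of_mem
      (show simpleRoot s ∈ posPair M ρ v from ⟨simpleRoot_mem_posRootSet ρ s, hs⟩) hfin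
    omega
  obtain ⟨w, k, hk, he⟩ := ih _ hlt _ ((hfin'.image _).subset hsub) rfl
    (fun w => by rw [← rho_mul]; exact hpos _)
  refine ⟨cs.simple s * w, k, hk, ?_⟩
  rw [rho_mul, ← he, rho_simple_simple cs ρ hρ]

lemma orbK_add {u v : B → ℝ} (hu : u ∈ orbK M ρ) (hv : v ∈ orbK M ρ) : u + v ∈ orbK M ρ := by
  obtain ⟨w, k, hk, rfl⟩ := hu
  obtain ⟨w', k', hk', rfl⟩ := hv
  refine mem_orbK_of cs ρ hρ _ _ ?_ rfl ?_
  · refine ((posPair_finite cs ρ hρ w hk).union (posPair_finite cs ρ hρ w' hk')).subset ?_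
    rintro α ⟨hα, hp⟩
    rw [coxForm_add_left] at hp
    by_cases h : 0 < coxForm M (ρ w k) α
    · exact Or.inl ⟨hα, h⟩
    · exact Or.inr ⟨hα, by linarith⟩
  · intro x
    rw [map_add, ← rho_mul, ← rho_mul]
    exact add_nonneg (rho_coneK_nonneg cs ρ hρ _ _ _ rfl hk)
      (rho_coneK_nonneg cs ρ hρ _ _ _ rfl hk')

omit hρ in
lemma orbK_smul {c : ℝ} (hc : 0 ≤ c) {v : B → ℝ} (hv : v ∈ orbK M ρ) : c • v ∈ orbK M ρ := by
  obtain ⟨w, k, hk, rfl⟩ := hv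
  refine ⟨w, c • k, ⟨fun i => mul_nonneg hc (hk.1 i), fun s => ?_⟩, (map_smul _ _ _).symm⟩
  rw [coxForm_smul_left]
  exact mul_nonpos_of_nonneg_of_nonpos hc (hk.2 s)

lemma imagCone_add {u v : B → ℝ} (hu : u ∈ imagCone M ρ) (hv : v ∈ imagCone M ρ) :
    u + v ∈ imagCone M ρ :=
  map_mem_closure₂ continuous_add hu hv (fun _ ha _ hb => orbK_add cs ρ hρ ha hb)

omit hρ in
lemma imagCone_smul {c : ℝ} (hc : 0 ≤ c) {v : B → ℝ} (hv : v ∈ imagCone M ρ) :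
    c • v ∈ imagCone M ρ :=
  map_mem_closure (continuous_const_smul c) hv (fun _ ha => orbK_smul ρ hc ha)

omit hρ in
lemma imagCone_rho (w : W) {v : B → ℝ} (hv : v ∈ imagCone M ρ) : ρ w v ∈ imagCone M ρ := by
  refine map_mem_closure (ρ w).toLinearMap.continuous_of_finiteDimensional hv ?_
  rintro _ ⟨w', k, hk, rfl⟩
  exact ⟨w * w', k, hk, (rho_mul ρ w w' k).symm⟩

lemma imagCone_nonneg {v : B → ℝ} (hv : v ∈ imagCone M ρ) : 0 ≤ v := by
  have hcl : IsClosed {v : B → ℝ | 0 ≤ v} := isClosed_Ici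
  refine closure_minimal ?_ hcl hv
  rintro _ ⟨w, k, hk, rfl⟩
  exact rho_coneK_nonneg cs ρ hρ _ _ _ rfl hk

omit hρ in
lemma imagCone_zero : (0 : B → ℝ) ∈ imagCone M ρ := by
  refine subset_closure ⟨1, 0, ⟨fun i => le_rfl, fun s => ?_⟩, by simp⟩
  simp [coxForm]

end cone

/-! ### Pairings and mid arguments -/

section pairing
variable {B : Type*} [Fintype B]

lemma evalC_add (z : B → ℂ) (u v : B → ℝ) : evalC z (u + v) = evalC z u + evalC z v := by
  simp [evalC, add_mul, Finset.sum_add_distrib]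

lemma evalC_smul (z : B → ℂ) (c : ℝ) (v : B → ℝ) : evalC z (c • v) = c * evalC z v := by
  simp [evalC, Finset.mul_sum, mul_assoc]

lemma evalC_neg (z : B → ℂ) (v : B → ℝ) : evalC z (-v) = - evalC z v := by
  simp [evalC]

lemma evalC_circle (c : Circle) (z : B → ℂ) (v : B → ℝ) :
    evalC (c • z) v = c * evalC z v := by
  simp only [evalC, Finset.mul_sum, Pi.smul_apply, Circle.smul_def, smul_eq_mul]
  refine Finset.sum_congr rfl fun i _ => ?_
  ring

lemma continuous_evalC : Continuous fun p : (B → ℂ) × (B → ℝ) => evalC p.1 p.2 := by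
  unfold evalC
  fun_prop

/-- The set of arguments of `Z(D)`. -/
def argSet (D : Set (B → ℝ)) (z : B → ℂ) : Set ℝ :=
  (fun v => Complex.arg (evalC z v)) '' D

noncomputable def midArg (D : Set (B → ℝ)) (z : B → ℂ) : ℝ :=
  (sSup (argSet D z) + sInf (argSet D z)) / 2

lemma argSet_bddAbove (D : Set (B → ℝ)) (z : B → ℂ) : BddAbove (argSet D z) :=
  ⟨Real.pi, by rintro _ ⟨v, -, rfl⟩; exact Complex.arg_le_pi _⟩

lemma argSet_bddBelow (D : Set (B → ℝ)) (z : B → ℂ) : BddBelow (argSet D z) :=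
  ⟨-Real.pi, by rintro _ ⟨v, -, rfl⟩; exact (Complex.neg_pi_lt_arg _).le⟩

lemma midArg_shift {D : Set (B → ℝ)} (hD : D.Nonempty) {z z' : B → ℂ} {θ : ℝ}
    (h : ∀ v ∈ D, Complex.arg (evalC z' v) = Complex.arg (evalC z v) + θ) :
    midArg D z' = midArg D z + θ := by
  have hA : argSet D z' = OrderIso.addRight θ '' argSet D z := by
    unfold argSet
    rw [Set.image_image]
    refine Set.image_congr fun v hv => ?_
    rw [h v hv]; rfl
  have hne : (argSet D z).Nonempty := hD.image _
  unfold midArg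
  rw [hA, ← OrderIso.map_csSup' _ hne (argSet_bddAbove D z),
    ← OrderIso.map_csInf' _ hne (argSet_bddBelow D z)]
  simp only [OrderIso.addRight_apply]
  ring

lemma circle_exp_mul_eq (x : ℂ) (θ : ℝ) :
    (Circle.exp θ : ℂ) * x = (‖x‖ : ℂ) * (Complex.cos ((Complex.arg x + θ : ℝ) : ℂ)
      + Complex.sin ((Complex.arg x + θ : ℝ) : ℂ) * Complex.I) := by
  rw [← Complex.exp_mul_I, Complex.ofReal_add, add_mul, Complex.exp_add, ← mul_assoc,
    Complex.norm_mul_exp_arg_mul_I, Circle.coe_exp, mul_comm]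

lemma arg_shift {x : ℂ} (hx : x ≠ 0) {θ : ℝ}
    (h : Complex.arg x + θ ∈ Set.Ioc (-Real.pi) Real.pi) :
    Complex.arg ((Circle.exp θ : ℂ) * x) = Complex.arg x + θ := by
  rw [circle_exp_mul_eq]
  exact Complex.arg_mul_cos_add_sin_mul_I (norm_pos_iff.2 hx) h

lemma im_shift (x : ℂ) (θ : ℝ) :
    ((Circle.exp θ : ℂ) * x).im = ‖x‖ * Real.sin (Complex.arg x + θ) := by
  rw [circle_exp_mul_eq, ← Complex.ofReal_cos, ← Complex.ofReal_sin, Complex.im_ofReal_mul,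
    Complex.add_im, Complex.ofReal_im, Complex.im_ofReal_mul, Complex.I_im]
  ring

lemma arg_mem_of_im_pos {x : ℂ} (hx : 0 < x.im) : 0 < Complex.arg x ∧ Complex.arg x < Real.pi := by
  have h0 := Complex.arg_nonneg_iff.2 hx.le
  have h1 : Complex.arg x ≠ 0 := by
    intro h
    have := Complex.norm_mul_sin_arg x
    rw [h, Real.sin_zero, mul_zero] at this
    linarith
  have h2 : Complex.arg x ≠ Real.pi := by
    intro h
    have := Complex.norm_mul_sin_arg x
    rw [h, Real.sin_pi, mul_zero] at this
    linarith
  exact ⟨lt_of_le_of_ne h0 (Ne.symm h1), lt_of_le_of_ne (Complex.arg_le_pi x) h2⟩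

lemma argSet_isCompact {D : Set (B → ℝ)} (hD : IsCompact D) {z : B → ℂ}
    (h : ∀ v ∈ D, 0 < (evalC z v).re) : IsCompact (argSet D z) := by
  refine hD.image_of_continuousOn fun v hv => ContinuousAt.continuousWithinAt ?_
  have h1 : ContinuousAt (fun v => evalC z v) v :=
    (continuous_evalC.comp (Continuous.prodMk continuous_const continuous_id)).continuousAt
  exact (Complex.continuousAt_arg (Or.inl (h v hv))).comp h1

/-- Rotation of a family of arguments in the right half plane to the normalised position. -/
lemma normalise {D : Set (B → ℝ)} (hD : IsCompact D) (hne : D.Nonempty) {z : B → ℂ}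
    (h : ∀ v ∈ D, 0 < (evalC z v).re) :
    (∀ v ∈ D, 0 < (evalC (Circle.exp (Real.pi / 2 - midArg D z) • z) v).im) ∧
      midArg D (Circle.exp (Real.pi / 2 - midArg D z) • z) = Real.pi / 2 := by
  have hc := argSet_isCompact hD h
  have hn : (argSet D z).Nonempty := hne.image _
  have hlt : ∀ a ∈ argSet D z, |a| < Real.pi / 2 := by
    rintro _ ⟨v, hv, rfl⟩
    exact Complex.abs_arg_lt_pi_div_two_iff.2 (Or.inl (h v hv))
  have hS := abs_lt.1 (hlt _ (hc.sSup_mem hn))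
  have hs := abs_lt.1 (hlt _ (hc.sInf_mem hn))
  have key : ∀ v ∈ D, 0 < Complex.arg (evalC z v) + (Real.pi / 2 - midArg D z) ∧
      Complex.arg (evalC z v) + (Real.pi / 2 - midArg D z) < Real.pi := by
    intro v hv
    have hm : Complex.arg (evalC z v) ∈ argSet D z := ⟨v, hv, rfl⟩
    have h1 := le_csSup (argSet_bddAbove D z) hm
    have h2 := csInf_le (argSet_bddBelow D z) hm
    unfold midArg
    constructor <;> linarith
  have hx : ∀ v ∈ D, evalC z v ≠ 0 := by
    intro v hv h0
    have := h v hv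
    rw [h0] at this
    simp at this
  constructor
  · intro v hv
    rw [evalC_circle, im_shift]
    exact mul_pos (norm_pos_iff.2 (hx v hv))
      (Real.sin_pos_of_pos_of_lt_pi (key v hv).1 (key v hv).2)
  · rw [midArg_shift hne (z := z) (θ := Real.pi / 2 - midArg D z)]
    · ring
    · intro v hv
      rw [evalC_circle]
      exact arg_shift (hx v hv) ⟨by linarith [(key v hv).1, Real.pi_pos], (key v hv).2.le⟩

lemma normalise_unique {D : Set (B → ℝ)} (hne : D.Nonempty) {z : B → ℂ} {c : Circle}
    (h : ∀ v ∈ D, 0 < (evalC z v).im) (h' : ∀ v ∈ D, 0 < (evalC (c • z) v).im)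
    (hm : midArg D z = midArg D (c • z)) : c = 1 := by
  obtain ⟨θ, hθ, rfl⟩ : ∃ θ ∈ Set.Ioc (-Real.pi) Real.pi, Circle.exp θ = c :=
    ⟨Complex.arg c, Complex.arg_mem_Ioc _, Circle.exp_arg c⟩
  have := midArg_shift hne (z := z) (z' := Circle.exp θ • z) (θ := θ) (fun v hv => by
    have ha := arg_mem_of_im_pos (h v hv)
    have hx : evalC z v ≠ 0 := by
      intro h0
      have := h v hv
      rw [h0] at this
      simp at this
    have h1 := h' v hv
    rw [evalC_circle] at h1 ⊢
    refine arg_shift hx ⟨by linarith [hθ.1], ?_⟩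
    by_contra hgt
    push Not at hgt
    rw [im_shift] at h1
    have h2 : Real.sin (Complex.arg (evalC z v) + θ) < 0 := by
      have := Real.sin_pos_of_pos_of_lt_pi
        (x := Complex.arg (evalC z v) + θ - Real.pi) (by linarith) (by linarith [hθ.2])
      rw [Real.sin_sub_pi] at this
      linarith
    have h3 := mul_neg_of_pos_of_neg (norm_pos_iff.2 hx) h2
    linarith)
  have h0 : θ = 0 := by linarith
  rw [h0, Circle.exp_zero]

lemma exists_rotation {D : Set (B → ℝ)} (hD : IsCompact D) (hconv : Convex ℝ D)
    (hne : D.Nonempty) {z : B → ℂ} (h : ∀ v ∈ D, evalC z v ≠ 0) :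
    ∃ c : Circle, ∀ v ∈ D, 0 < (evalC (c • z) v).re := by
  let L : (B → ℝ) →ₗ[ℝ] ℂ :=
    { toFun := fun v => evalC z v
      map_add' := evalC_add z
      map_smul' := fun c v => by rw [evalC_smul]; simp }
  have hcont : Continuous (fun v => evalC z v) :=
    continuous_evalC.comp (Continuous.prodMk continuous_const continuous_id)
  have hcl : IsClosed (L '' D) := (hD.image hcont).isClosed
  have hcv : Convex ℝ (L '' D) := hconv.linear_image L
  have h0 : (0 : ℂ) ∉ L '' D := by
    rintro ⟨v, hv, he⟩
    exact h v hv he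
  obtain ⟨f, u, hf0, hfu⟩ := geometric_hahn_banach_point_closed hcv hcl h0
  rw [map_zero] at hf0
  have hf : ∀ x : ℂ, f x = ((⟨f 1, - f Complex.I⟩ : ℂ) * x).re := by
    intro x
    have hx : x = x.re • (1 : ℂ) + x.im • Complex.I := by
      apply Complex.ext <;> simp
    conv_lhs => rw [hx]
    rw [map_add, map_smul, map_smul]
    simp [Complex.mul_re]
    ring
  set c : ℂ := ⟨f 1, - f Complex.I⟩ with hc
  refine ⟨Circle.exp (Complex.arg c), fun v hv => ?_⟩
  have h1 : 0 < f (evalC z v) := hf0.trans (hfu _ ⟨v, hv, rfl⟩)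
  rw [hf, ← Complex.norm_mul_exp_arg_mul_I c, mul_assoc, Complex.re_ofReal_mul] at h1
  rw [evalC_circle, Circle.coe_exp]
  exact (pos_iff_pos_of_mul_pos h1).1 (lt_of_le_of_ne (norm_nonneg _)
    fun h => by rw [← h, zero_mul] at h1; exact lt_irrefl _ h1)

lemma isOpen_rightHalf {D : Set (B → ℝ)} (hD : IsCompact D) :
    IsOpen {z : B → ℂ | ∀ v ∈ D, 0 < (evalC z v).re} := by
  rw [isOpen_iff_eventually]
  intro z hz
  refine hD.eventually_forall_of_forall_eventually fun v hv => ?_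
  have : Continuous fun p : (B → ℂ) × (B → ℝ) => (evalC p.1 p.2).re :=
    Complex.continuous_re.comp continuous_evalC
  exact this.continuousAt.eventually (lt_mem_nhds (hz v hv))

lemma midArg_continuousAt {D : Set (B → ℝ)} (hD : IsCompact D) {z : B → ℂ}
    (h : ∀ v ∈ D, 0 < (evalC z v).re) : ContinuousAt (midArg D) z := by
  set P : Set (B → ℂ) := {z : B → ℂ | ∀ v ∈ D, 0 < (evalC z v).re} with hP
  have hPo : IsOpen P := isOpen_rightHalf hD
  suffices hon : ContinuousOn (midArg D) P from hon.continuousAt (hPo.mem_nhds h)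
  rw [continuousOn_iff_continuous_domRestrict]
  have : CompactSpace D := isCompact_iff_compactSpace.1 hD
  let f : P → D → ℝ := fun y v => Complex.arg (evalC y.1 v.1)
  have hf : Continuous (fun p : P × D => f p.1 p.2) := by
    rw [continuous_iff_continuousAt]
    rintro ⟨y, v⟩
    have h1 : Continuous fun p : P × D => evalC p.1.1 p.2.1 :=
      continuous_evalC.comp ((continuous_subtype_val.comp continuous_fst).prodMk
        (continuous_subtype_val.comp continuous_snd))
    exact ContinuousAt.comp (f := fun p : P × D => evalC p.1.1 p.2.1) (g := Complex.arg)
      (Complex.continuousAt_arg (Or.inl (y.2 v.1 v.2))) h1.continuousAt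
  have hA : ∀ y : P, argSet D y.1 = f y '' Set.univ := by
    intro y
    ext a
    constructor
    · rintro ⟨v, hv, rfl⟩
      exact ⟨⟨v, hv⟩, trivial, rfl⟩
    · rintro ⟨v, -, rfl⟩
      exact ⟨v.1, v.2, rfl⟩
  have he : P.domRestrict (midArg D) =
      fun y => (sSup (f y '' Set.univ) + sInf (f y '' Set.univ)) / 2 := by
    funext y
    simp only [Set.domRestrict_apply, midArg, hA]
  rw [he]
  exact ((isCompact_univ.continuous_sSup hf).add (isCompact_univ.continuous_sInf hf)).div_const 2

/-- If the (principal) mid argument is `π / 2`, then `Z(D)` lies in the open upper half plane. -/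
lemma im_pos_of_midArg {D : Set (B → ℝ)} (hD : IsCompact D) (hconv : Convex ℝ D)
    (hne : D.Nonempty) {z : B → ℂ} (h : ∀ v ∈ D, evalC z v ≠ 0)
    (hm : midArg D z = Real.pi / 2) : ∀ v ∈ D, 0 < (evalC z v).im := by
  have hn : (argSet D z).Nonempty := hne.image _
  have hSle : sSup (argSet D z) ≤ Real.pi :=
    csSup_le hn (by rintro _ ⟨v, -, rfl⟩; exact Complex.arg_le_pi _)
  unfold midArg at hm
  have hge : ∀ v ∈ D, 0 ≤ Complex.arg (evalC z v) := by
    intro v hv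
    have := csInf_le (argSet_bddBelow D z) (show Complex.arg (evalC z v) ∈ _ from ⟨v, hv, rfl⟩)
    linarith
  have him : ∀ v ∈ D, 0 ≤ (evalC z v).im := fun v hv => Complex.arg_nonneg_iff.1 (hge v hv)
  have hcont : Continuous (fun v => evalC z v) :=
    continuous_evalC.comp (Continuous.prodMk continuous_const continuous_id)
  have hcomp : IsCompact (argSet D z) := by
    have : argSet D z = (fun v => Real.arccos ((evalC z v).re / ‖evalC z v‖)) '' D :=
      Set.image_congr fun v hv => Complex.arg_of_im_nonneg_of_ne_zero (him v hv) (h v hv)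
    rw [this]
    refine hD.image_of_continuousOn (Real.continuous_arccos.comp_continuousOn ?_)
    exact ContinuousOn.div (Complex.continuous_re.comp hcont).continuousOn
      (continuous_norm.comp hcont).continuousOn fun v hv => norm_ne_zero_iff.2 (h v hv)
  obtain ⟨p, hp, hpS⟩ := hcomp.sSup_mem hn
  obtain ⟨q, hq, hqs⟩ := hcomp.sInf_mem hn
  simp only at hpS hqs
  intro v hv
  by_contra hv0
  have hv0 : (evalC z v).im = 0 := le_antisymm (not_lt.1 hv0) (him v hv)
  have h1 := le_csSup (argSet_bddAbove D z)
    (show Complex.arg (evalC z v) ∈ _ from ⟨v, hv, rfl⟩)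
  have h2 := csInf_le (argSet_bddBelow D z)
    (show Complex.arg (evalC z v) ∈ _ from ⟨v, hv, rfl⟩)
  have hv1 : Complex.arg (evalC z v) = 0 ∨ Complex.arg (evalC z v) = Real.pi := by
    rcases le_or_gt 0 (evalC z v).re with hr | hr
    · exact Or.inl (Complex.arg_eq_zero_iff.2 ⟨hr, hv0⟩)
    · exact Or.inr (Complex.arg_eq_pi_iff.2 ⟨hr, hv0⟩)
  have hq0 := hge q hq
  have hP : Complex.arg (evalC z p) = Real.pi ∧ Complex.arg (evalC z q) = 0 := by
    have := Complex.arg_le_pi (evalC z p)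
    rcases hv1 with h3 | h3 <;> constructor <;> linarith
  obtain ⟨hpr, hpi⟩ := Complex.arg_eq_pi_iff.1 hP.1
  obtain ⟨hqr, hqi⟩ := Complex.arg_eq_zero_iff.1 hP.2
  set a := (evalC z q).re with ha
  set b := -(evalC z p).re with hb
  have hbp : 0 < a + b := by linarith
  have hmem := hconv hp hq (a := a / (a + b)) (b := b / (a + b))
    (by positivity) (div_nonneg (by linarith) hbp.le) (by field_simp)
  apply h _ hmem
  rw [evalC_add, evalC_smul, evalC_smul]
  apply Complex.ext
  · rw [Complex.add_re, Complex.re_ofReal_mul, Complex.re_ofReal_mul, ← ha]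
    have : (evalC z p).re = -b := by rw [hb]; ring
    rw [this, Complex.zero_re]
    ring
  · rw [Complex.add_im, Complex.im_ofReal_mul, Complex.im_ofReal_mul, hpi, hqi]
    simp

end pairing

/-! ### The compact slice of the imaginary cone and the splitting -/

/-- The slice of the imaginary cone by the affine hyperplane `∑ v_i = 1`. -/
def slice {B : Type*} [Fintype B] [DecidableEq B] (M : CoxeterMatrix B)
    {W : Type*} [Group W] (ρ : W →* ((B → ℝ) ≃ₗ[ℝ] (B → ℝ))) : Set (B → ℝ) :=
  {v | v ∈ imagCone M ρ ∧ ∑ i, v i = 1}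

section splitting
variable {B : Type*} [Fintype B] [DecidableEq B] {M : CoxeterMatrix B}
  {W : Type*} [Group W] (cs : CoxeterSystem M W)
  (ρ : W →* ((B → ℝ) ≃ₗ[ℝ] (B → ℝ)))
  (hρ : ∀ (s : B) (v : B → ℝ),
      ρ (cs.simple s) v = v - coxForm M (simpleRoot s) v • simpleRoot s)

lemma evalC_simpleRoot (z : B → ℂ) (i : B) : evalC z (simpleRoot i) = z i := by
  unfold evalC simpleRoot
  rw [Finset.sum_eq_single i]
  · simp
  · intro b _ hb; simp [hb]
  · simp

lemma evalC_wact (w : W) (z : B → ℂ) (v : B → ℝ) :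
    evalC (wact ρ w z) v = evalC z (ρ w⁻¹ v) := by
  let L : (B → ℝ) →ₗ[ℝ] ℂ :=
    { toFun := fun v => evalC z v
      map_add' := evalC_add z
      map_smul' := fun c v => by rw [evalC_smul]; simp }
  have h : evalC z (ρ w⁻¹ v) = L (ρ w⁻¹ v) := rfl
  rw [h]
  conv_rhs => rw [vec_eq_sum v]
  rw [map_sum, map_sum]
  refine Finset.sum_congr rfl fun i _ => ?_
  rw [map_smul, map_smul, Complex.real_smul]
  rfl

lemma wact_circle (w : W) (c : Circle) (z : B → ℂ) : wact ρ w (c • z) = c • wact ρ w z := by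
  funext i
  exact evalC_circle c z _

lemma upsReg_circle (c : Circle) {z : B → ℂ} (hz : z ∈ upsReg M ρ) : c • z ∈ upsReg M ρ := by
  refine ⟨fun v hv h0 => ?_, fun α hα => ?_⟩
  · rw [evalC_circle]
    exact mul_ne_zero c.coe_ne_zero (hz.1 v hv h0)
  · rw [evalC_circle]
    exact mul_ne_zero c.coe_ne_zero (hz.2 α hα)

lemma phiI_wact (w : W) (z : B → ℂ) : phiI M ρ (wact ρ w z) = phiI M ρ z := by
  have h : (fun v => evalC (wact ρ w z) v) '' (imagCone M ρ \ {0}) =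
      (fun v => evalC z v) '' (imagCone M ρ \ {0}) := by
    ext x
    constructor
    · rintro ⟨v, ⟨hv, h0⟩, rfl⟩
      refine ⟨ρ w⁻¹ v, ⟨imagCone_rho ρ w⁻¹ hv, ?_⟩, (evalC_wact ρ w z v).symm⟩
      simpa using h0
    · rintro ⟨v, ⟨hv, h0⟩, rfl⟩
      refine ⟨ρ w v, ⟨imagCone_rho ρ w hv, ?_⟩, ?_⟩
      · simpa using h0
      · simp only
        rw [evalC_wact, rho_inv_rho]
  unfold phiI
  rw [h]

include hρ

lemma upsReg_wact (w : W) {z : B → ℂ} (hz : z ∈ upsReg M ρ) : wact ρ w z ∈ upsReg M ρ := by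
  refine ⟨fun v hv h0 => ?_, fun α hα => ?_⟩
  · rw [evalC_wact]
    exact hz.1 _ (imagCone_rho ρ w⁻¹ hv) (by simpa using h0)
  · rw [evalC_wact]
    rcases rootSet_pos_or_neg cs ρ hρ (rootSet_rho ρ w⁻¹ hα.1) with h | h
    · exact hz.2 _ h
    · have := hz.2 _ h
      rw [evalC_neg] at this
      exact neg_ne_zero.1 this

lemma sum_pos_of_mem {v : B → ℝ} (hv : v ∈ imagCone M ρ) (h0 : v ≠ 0) : 0 < ∑ i, v i := by
  have hn := imagCone_nonneg cs ρ hρ hv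
  refine lt_of_le_of_ne (Finset.sum_nonneg fun i _ => hn i) fun h => h0 ?_
  funext i
  exact (Finset.sum_eq_zero_iff_of_nonneg fun i _ => hn i).1 h.symm i (Finset.mem_univ i)

omit hρ in
lemma slice_ne_zero {v : B → ℝ} (hv : v ∈ slice M ρ) : v ≠ 0 := by
  rintro rfl
  have := hv.2
  simp at this

lemma smul_mem_slice {v : B → ℝ} (hv : v ∈ imagCone M ρ) (h0 : v ≠ 0) :
    (∑ i, v i)⁻¹ • v ∈ slice M ρ := by
  have hp := sum_pos_of_mem cs ρ hρ hv h0
  refine ⟨imagCone_smul ρ (inv_nonneg.2 hp.le) hv, ?_⟩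
  simp only [Pi.smul_apply, smul_eq_mul, ← Finset.mul_sum]
  exact inv_mul_cancel₀ hp.ne'

lemma slice_nonempty (hI : imagCone M ρ ≠ {0}) : (slice M ρ).Nonempty := by
  obtain ⟨v, hv, h0⟩ : ∃ v ∈ imagCone M ρ, v ≠ 0 := by
    by_contra hcon
    push Not at hcon
    apply hI
    ext v
    exact ⟨fun h => hcon v h, fun h => by rw [Set.mem_singleton_iff.1 h]; exact imagCone_zero ρ⟩
  exact ⟨_, smul_mem_slice cs ρ hρ hv h0⟩

lemma slice_compact : IsCompact (slice M ρ) := by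
  have hcl : IsClosed (slice M ρ) := by
    have h2 : IsClosed {v : B → ℝ | ∑ i, v i = 1} :=
      isClosed_eq (by fun_prop) continuous_const
    exact (isClosed_closure (s := orbK M ρ)).inter h2
  refine (isCompact_Icc (a := (0 : B → ℝ)) (b := 1)).of_isClosed_subset hcl ?_
  rintro v ⟨hv, hs⟩
  have hn := imagCone_nonneg cs ρ hρ hv
  refine ⟨hn, fun i => ?_⟩
  rw [Pi.one_apply, ← hs]
  exact Finset.single_le_sum (fun j _ => hn j) (Finset.mem_univ i)

lemma slice_convex : Convex ℝ (slice M ρ) := by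
  intro u hu v hv a b ha hb hab
  refine ⟨imagCone_add cs ρ hρ (imagCone_smul ρ ha hu.1) (imagCone_smul ρ hb hv.1), ?_⟩
  simp only [Pi.add_apply, Pi.smul_apply, smul_eq_mul, Finset.sum_add_distrib, ← Finset.mul_sum]
  rw [hu.2, hv.2]; linarith

lemma phiI_eq_midArg (z : B → ℂ) : phiI M ρ z = midArg (slice M ρ) z := by
  have h : Complex.arg '' ((fun v => evalC z v) '' (imagCone M ρ \ {0})) =
      argSet (slice M ρ) z := by
    ext a
    constructor
    · rintro ⟨_, ⟨v, ⟨hv, h0⟩, rfl⟩, rfl⟩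
      refine ⟨_, smul_mem_slice cs ρ hρ hv h0, ?_⟩
      simp only
      rw [evalC_smul, Complex.arg_real_mul _ (inv_pos.2 (sum_pos_of_mem cs ρ hρ hv h0))]
    · rintro ⟨v, hv, rfl⟩
      exact ⟨_, ⟨v, ⟨hv.1, slice_ne_zero ρ hv⟩, rfl⟩, rfl⟩
  unfold phiI midArg
  rw [h]

lemma mem_upsRegN_iff (hI : imagCone M ρ ≠ {0}) (z : B → ℂ) :
    z ∈ upsRegN M ρ ↔ z ∈ upsReg M ρ ∧ (∀ v ∈ slice M ρ, 0 < (evalC z v).im) ∧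
      midArg (slice M ρ) z = Real.pi / 2 := by
  unfold upsRegN
  rw [if_neg hI]
  constructor
  · rintro ⟨hz, hp⟩
    rw [phiI_eq_midArg cs ρ hρ] at hp
    exact ⟨hz, im_pos_of_midArg (slice_compact cs ρ hρ) (slice_convex cs ρ hρ)
      (slice_nonempty cs ρ hρ hI) (fun v hv => hz.1 v hv.1 (slice_ne_zero ρ hv)) hp, hp⟩
  · rintro ⟨hz, -, hp⟩
    exact ⟨hz, by rw [phiI_eq_midArg cs ρ hρ]; exact hp⟩

lemma upsRegN_wact (hI : imagCone M ρ ≠ {0}) (w : W) {z : B → ℂ} (hz : z ∈ upsRegN M ρ) :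
    wact ρ w z ∈ upsRegN M ρ := by
  unfold upsRegN at hz ⊢
  rw [if_neg hI] at hz ⊢
  exact ⟨upsReg_wact cs ρ hρ w hz.1, by rw [phiI_wact]; exact hz.2⟩

lemma rotate_mem (hI : imagCone M ρ ≠ {0}) {z : B → ℂ} (hz : z ∈ upsReg M ρ) (c : Circle)
    (h : ∀ v ∈ slice M ρ, 0 < (evalC (c • z) v).re) :
    ((Circle.exp (Real.pi / 2 - midArg (slice M ρ) (c • z)) * c)⁻¹)⁻¹ • z ∈ upsRegN M ρ := by
  rw [inv_inv, mul_smul, mem_upsRegN_iff cs ρ hρ hI]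
  exact ⟨upsReg_circle ρ _ (upsReg_circle ρ c hz),
    normalise (slice_compact cs ρ hρ) (slice_nonempty cs ρ hρ hI) h⟩

lemma exists_rotate (hI : imagCone M ρ ≠ {0}) {z : B → ℂ} (hz : z ∈ upsReg M ρ) :
    ∃ c : Circle, ∀ v ∈ slice M ρ, 0 < (evalC (c • z) v).re :=
  exists_rotation (slice_compact cs ρ hρ) (slice_convex cs ρ hρ)
    (slice_nonempty cs ρ hρ hI) (fun v hv => hz.1 v hv.1 (slice_ne_zero ρ hv))

lemma rotate_unique (hI : imagCone M ρ ≠ {0}) {z : B → ℂ} {a b : Circle}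
    (ha : a⁻¹ • z ∈ upsRegN M ρ) (hb : b⁻¹ • z ∈ upsRegN M ρ) : a = b := by
  rw [mem_upsRegN_iff cs ρ hρ hI] at ha hb
  have he : (b⁻¹ * a) • (a⁻¹ • z) = b⁻¹ • z := by
    rw [smul_smul, mul_assoc, mul_inv_cancel, mul_one]
  have := normalise_unique (slice_nonempty cs ρ hρ hI) (z := a⁻¹ • z) (c := b⁻¹ * a)
    ha.2.1 (by rw [he]; exact hb.2.1) (by rw [he, ha.2.2, hb.2.2])
  exact (inv_mul_eq_one.1 this).symm

end splitting

/-!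
STATEMENT 10: When I ≠ {0}, the normalised hyperplane complement Υ_reg^N is a W-invariant
subset of Υ_reg, and the homeomorphism Υ_reg ≅ S¹ × Υ_reg^N coming from the free
S¹-scaling action can be chosen to be W-equivariant.
-/
theorem upsRegN_invariant_and_equivariant_splitting
    {B : Type*} [Fintype B] [DecidableEq B] (M : CoxeterMatrix B)
    {W : Type*} [Group W] (cs : CoxeterSystem M W)
    (ρ : W →* ((B → ℝ) ≃ₗ[ℝ] (B → ℝ)))
    (hρ : ∀ (s : B) (v : B → ℝ),
      ρ (cs.simple s) v = v - coxForm M (simpleRoot s) v • simpleRoot s)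
    (hI : imagCone M ρ ≠ {0}) :
    (∀ (w : W), ∀ z ∈ upsRegN M ρ, wact ρ w z ∈ upsRegN M ρ) ∧
      ∃ h : ↥(upsReg M ρ) ≃ₜ Circle × ↥(upsRegN M ρ),
        ∀ (w : W) (z z' : ↥(upsReg M ρ)), (z' : B → ℂ) = wact ρ w (z : B → ℂ) →
          (h z').1 = (h z).1 ∧ ((h z').2 : B → ℂ) = wact ρ w ((h z).2 : B → ℂ) := by
  refine ⟨fun w z hz => upsRegN_wact cs ρ hρ hI w hz, ?_⟩
  have hex : ∀ z : ↥(upsReg M ρ), ∃ c : Circle, c⁻¹ • (z : B → ℂ) ∈ upsRegN M ρ := by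
    intro z
    obtain ⟨c, hc⟩ := exists_rotate cs ρ hρ hI z.2
    exact ⟨_, rotate_mem cs ρ hρ hI z.2 c hc⟩
  choose c hc using hex
  have huniq : ∀ (z : ↥(upsReg M ρ)) (a : Circle), a⁻¹ • (z : B → ℂ) ∈ upsRegN M ρ → c z = a :=
    fun z a ha => rotate_unique cs ρ hρ hI (hc z) ha
  have hsub : ∀ z ∈ upsRegN M ρ, z ∈ upsReg M ρ :=
    fun z hz => ((mem_upsRegN_iff cs ρ hρ hI z).1 hz).1
  have hcont : Continuous c := by
    rw [continuous_iff_continuousAt]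
    intro z₀
    obtain ⟨μ, hμ⟩ := exists_rotate cs ρ hρ hI z₀.2
    have hsm : Continuous fun z : ↥(upsReg M ρ) => μ • (z : B → ℂ) :=
      continuous_subtype_val.const_smul μ
    have hev : ∀ᶠ z : ↥(upsReg M ρ) in nhds z₀,
        (Circle.exp (Real.pi / 2 - midArg (slice M ρ) (μ • (z : B → ℂ))) * μ)⁻¹ = c z := by
      have hU := ((isOpen_rightHalf (slice_compact cs ρ hρ)).preimage hsm).mem_nhds
        (show z₀ ∈ _ from hμ)
      filter_upwards [hU] with z hz
      exact (huniq z _ (rotate_mem cs ρ hρ hI z.2 μ hz)).symm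
    refine ContinuousAt.congr ?_ hev
    have h1 : ContinuousAt (fun z : ↥(upsReg M ρ) => midArg (slice M ρ) (μ • (z : B → ℂ))) z₀ :=
      ContinuousAt.comp (f := fun z : ↥(upsReg M ρ) => μ • (z : B → ℂ))
        (midArg_continuousAt (slice_compact cs ρ hρ) hμ) hsm.continuousAt
    exact ((Circle.exp.continuous.continuousAt.comp
      (continuousAt_const.sub h1)).mul continuousAt_const).inv
  let h : ↥(upsReg M ρ) ≃ₜ Circle × ↥(upsRegN M ρ) :=
    { toFun := fun z => (c z, ⟨(c z)⁻¹ • (z : B → ℂ), hc z⟩)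
      invFun := fun p => ⟨p.1 • (p.2 : B → ℂ), upsReg_circle ρ p.1 (hsub _ p.2.2)⟩
      left_inv := fun z => by
        apply Subtype.ext
        simp
      right_inv := fun p => by
        obtain ⟨a, n⟩ := p
        have ha : c ⟨a • (n : B → ℂ), upsReg_circle ρ a (hsub _ n.2)⟩ = a :=
          huniq _ _ (by simp)
        refine Prod.ext ha (Subtype.ext ?_)
        simp only [ha, inv_smul_smul]
      continuous_toFun := by
        refine hcont.prodMk (Continuous.subtype_mk ?_ _)
        exact hcont.inv.smul continuous_subtype_val
      continuous_invFun := by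
        refine Continuous.subtype_mk ?_ _
        exact continuous_fst.smul (continuous_subtype_val.comp continuous_snd) }
  refine ⟨h, fun w z z' hz => ?_⟩
  have hcz : c z' = c z := by
    refine huniq z' _ ?_
    rw [hz, ← wact_circle]
    exact upsRegN_wact cs ρ hρ hI w (hc z)
  refine ⟨hcz, ?_⟩
  change (c z')⁻¹ • (z' : B → ℂ) = wact ρ w ((c z)⁻¹ • (z : B → ℂ))
  rw [hcz, hz, wact_circle]
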